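/- (Strict improvement of the local gain for genuinely heterogeneous networks.) Let P ≥ 2, m_1,…,m_P ≥ 2 integers, r_1,…,r_P positive integers, r = Σ_p r_p, K = Σ_p m_p·r_p. If the m_p are not all equal (i.e., there exist p ≠ q with m_p ≠ m_q), then the inequality is strict: L_u = r/(Σ_p r_p·m_p/(m_p − 1)) < 1 − r/K. -/

import Mathlib

/-- Strict Cauchy–Schwarz inequality for positive weights `w` and a non-constant positive
function `x`. -/
theorem sq_sum_lt_sum_mul_mul_sum_div {ι : Type*} [Fintype ι] {w x : ι → ℝ}
    (hw : ∀ i, 0 < w i) (hx : ∀ i, 0 < x i) (hne : ∃ i j, x i ≠ x j) :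
    (∑ i, w i) ^ 2 < (∑ i, w i * x i) * ∑ i, w i / x i := by
  obtain ⟨i, j, hij⟩ := hne
  have hW : 0 < ∑ i, w i := Finset.sum_pos (fun i _ => hw i) ⟨i, Finset.mem_univ i⟩
  have hD : 0 < ∑ i, w i * x i :=
    Finset.sum_pos (fun i _ => mul_pos (hw i) (hx i)) ⟨i, Finset.mem_univ i⟩
  set W := ∑ i, w i
  set D := ∑ i, w i * x i
  have hpos : 0 < ∑ i, w i * (W * x i - D) ^ 2 / x i := by
    refine Finset.sum_pos' (fun k _ => ?_) ?_
    · have := hw k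
      have := hx k
      positivity
    · obtain ⟨k, hk⟩ : ∃ k, W * x k - D ≠ 0 := by
        by_contra! h
        exact hij (mul_left_cancel₀ hW.ne' (by linarith [h i, h j]))
      have := hw k
      have := hx k
      exact ⟨k, Finset.mem_univ k, by positivity⟩
  have hexpand : ∑ i, w i * (W * x i - D) ^ 2 / x i =
      D * (D * (∑ i, w i / x i) - W ^ 2) := by
    calc ∑ i, w i * (W * x i - D) ^ 2 / x i
        = ∑ i, (W ^ 2 * (w i * x i) - 2 * W * D * w i + D ^ 2 * (w i / x i)) := by
          refine Finset.sum_congr rfl fun k _ => ?_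
          have := (hx k).ne'
          field_simp
          ring
      _ = W ^ 2 * D - 2 * W * D * W + D ^ 2 * ∑ i, w i / x i := by
          rw [Finset.sum_add_distrib, Finset.sum_sub_distrib, ← Finset.mul_sum,
            ← Finset.mul_sum, ← Finset.mul_sum]
      _ = _ := by ring
  rw [hexpand] at hpos
  linarith [pos_of_mul_pos_right hpos hD.le]


/-- **strict improvement for genuinely heterogeneous networks.**
Let `P ≥ 2`, `m p ≥ 2` integers, `rp p` positive integers, `r = ∑ p, rp p`,
`K = ∑ p, m p * rp p`.  If the `m p` are not all equal, then
`L_u = r / (∑ p, rp p * m p / (m p - 1)) < 1 - r / K`. -/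
theorem stmt_7 (P : ℕ) (hP : 2 ≤ P) (m rp : Fin P → ℕ)
    (hm : ∀ p, 2 ≤ m p) (hrp : ∀ p, 1 ≤ rp p)
    (r K : ℕ) (hr : r = ∑ p, rp p) (hK : K = ∑ p, m p * rp p)
    (hne : ∃ p q : Fin P, p ≠ q ∧ m p ≠ m q) :
    (r : ℝ) / (∑ p, (rp p : ℝ) * (m p) / ((m p : ℝ) - 1)) < 1 - (r : ℝ) / (K : ℝ) := by
  obtain ⟨a, b, -, hab⟩ := hne
  have hw : ∀ p, (0 : ℝ) < rp p := fun p => by exact_mod_cast hrp p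
  have hx : ∀ p, (0 : ℝ) < (m p : ℝ) - 1 := fun p => by
    have : (2 : ℝ) ≤ m p := by exact_mod_cast hm p
    linarith
  have hcs := sq_sum_lt_sum_mul_mul_sum_div hw hx ⟨a, b, fun h => hab (by
    exact_mod_cast sub_left_injective h)⟩
  have hrR : (r : ℝ) = ∑ p, (rp p : ℝ) := by rw [hr]; push_cast; rfl
  have hKR : (K : ℝ) = r + ∑ p, (rp p : ℝ) * ((m p : ℝ) - 1) := by
    rw [hrR, hK, ← Finset.sum_add_distrib]
    push_cast
    exact Finset.sum_congr rfl fun p _ => by ring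
  have hS : ∑ p, (rp p : ℝ) * (m p) / ((m p : ℝ) - 1) =
      r + ∑ p, (rp p : ℝ) / ((m p : ℝ) - 1) := by
    rw [hrR, ← Finset.sum_add_distrib]
    refine Finset.sum_congr rfl fun p _ => ?_
    have := (hx p).ne'
    field_simp
    ring
  have hr0 : (0 : ℝ) < r := by
    rw [hrR]
    exact Finset.sum_pos (fun p _ => hw p) ⟨a, Finset.mem_univ a⟩
  have hD : 0 ≤ ∑ p, (rp p : ℝ) * ((m p : ℝ) - 1) :=
    Finset.sum_nonneg fun p _ => (mul_pos (hw p) (hx p)).le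
  have hT : 0 ≤ ∑ p, (rp p : ℝ) / ((m p : ℝ) - 1) :=
    Finset.sum_nonneg fun p _ => (div_pos (hw p) (hx p)).le
  rw [← hrR] at hcs
  rw [hS, hKR, one_sub_div (by positivity), div_lt_div_iff₀ (by positivity) (by positivity)]
  linarith
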